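/- Let P be a (Λ,F,Z,S) placement delivery array with Z < F, let L = (L_1,…,L_Λ) be an association profile with ∑_{λ=1}^Λ L_λ = K, and suppose N ≥ 2K. Let R_s = (∑_{s'=1}^{S} L_{τ_{s'}})/(F−Z) denote the worst-case rate of the PDA-based secretive coded caching scheme, where τ_{s'} = min{λ ∈ [Λ] : s' appears in column λ of P}. Then for any secretive shared-cache scheme with parameters (Λ, K, M, M_U = 1, N, B) and rate R (with users ordered so that users 1, …, L_1 attach to cache 1), one has R_s ≤ K ≤ Λ·L_1 ≤ Λ·R; in particular, the rate achieved by the secretive coded caching scheme obtained from a PDA is within a multiplicative factor Λ of the optimal secretive rate. -/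

import Mathlib

/-- A `(K,F,Z,S)` placement delivery array: an `F × K` array with entries in `{⋆} ∪ [S]`
(`⋆` encoded as `none`) satisfying conditions C1, C2, C3. -/
def IsPDA (K F Z S : ℕ) (P : Fin F → Fin K → Option (Fin S)) : Prop :=
  (∀ k : Fin K, ((Finset.univ : Finset (Fin F)).filter (fun j => P j k = none)).card = Z) ∧
  (∀ s : Fin S, ∃ (j : Fin F) (k : Fin K), P j k = some s) ∧
  (∀ (j₁ j₂ : Fin F) (k₁ k₂ : Fin K) (s : Fin S), (j₁, k₁) ≠ (j₂, k₂) →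
    P j₁ k₁ = some s → P j₂ k₂ = some s →
    j₁ ≠ j₂ ∧ k₁ ≠ k₂ ∧ P j₁ k₂ = none ∧ P j₂ k₁ = none)

/-- The generalized array `G` constructed from a `(Λ,F,Z,S)` PDA `P` and an association
profile `L`: columns are indexed by pairs `(λ, i)` with `λ ∈ [Λ]`, `i ∈ [L λ]`
(`i` encoded `0`-based as `Fin (L λ)`, the ordered-pair entry records the `1`-based index
`i + 1`); the entry in row `j` and column `(λ, i)` is `⋆` if `P j λ = ⋆` and the ordered
pair `(P j λ, i)` otherwise. -/
def GArr {Λ F S : ℕ} (P : Fin F → Fin Λ → Option (Fin S)) (L : Fin Λ → ℕ)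
    (j : Fin F) (c : Σ l : Fin Λ, Fin (L l)) : Option (Fin S × ℕ) :=
  (P j c.1).map (fun s => (s, (c.2 : ℕ) + 1))

noncomputable section

/-- Probability of an event `E` on a finite sample space with weight function `p`. -/
def pr {Ω : Type*} [Fintype Ω] (p : Ω → ℝ) (E : Set Ω) : ℝ :=
  ∑ ω : Ω, E.indicator p ω

/-- Shannon entropy (in bits) of a random variable `X` on a finite probability space
`(Ω, p)`: `H(X) = -∑_x P[X = x] log₂ P[X = x]`, written as the expectation
`∑_ω p ω · (− log₂ P[X = X ω])`. -/
def ent {Ω α : Type*} [Fintype Ω] (p : Ω → ℝ) (X : Ω → α) : ℝ :=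
  ∑ ω : Ω, p ω * (-Real.logb 2 (pr p {ω' | X ω' = X ω}))

/-- Conditional Shannon entropy `H(X | Y) = H(X, Y) − H(Y)` in bits. -/
def condEnt {Ω α β : Type*} [Fintype Ω] (p : Ω → ℝ) (X : Ω → α) (Y : Ω → β) : ℝ :=
  ent p (fun ω => (X ω, Y ω)) - ent p Y

/-- Mutual information `I(X ; Y) = H(X) + H(Y) − H(X, Y)` in bits. -/
def mutInf {Ω α β : Type*} [Fintype Ω] (p : Ω → ℝ) (X : Ω → α) (Y : Ω → β) : ℝ :=
  ent p X + ent p Y - ent p (fun ω => (X ω, Y ω))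

/-- On the support of `p`, the value of `X` determines the value of `Y`. -/
def Determines {Ω α β : Type*} (p : Ω → ℝ) (X : Ω → α) (Y : Ω → β) : Prop :=
  ∀ ω ω' : Ω, p ω ≠ 0 → p ω' ≠ 0 → X ω = X ω' → Y ω = Y ω'

theorem Determines.of_eq {Ω α β : Type*} {p : Ω → ℝ} {X : Ω → α} {Y : Ω → β}
    (h : ∀ ω ω', X ω = X ω' → Y ω = Y ω') : Determines p X Y :=
  fun ω ω' _ _ hx => h ω ω' hx

section Entropy

variable {Ω α β γ : Type*} [Fintype Ω] {p : Ω → ℝ}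

theorem pr_setOf (p : Ω → ℝ) (q : Ω → Prop) [DecidablePred q] :
    pr p {ω | q ω} = ∑ ω, if q ω then p ω else 0 := by
  classical
  simp [pr, Set.indicator_apply]

theorem pr_mono (hp : ∀ ω, 0 ≤ p ω) {q r : Ω → Prop} (h : ∀ ω, p ω ≠ 0 → q ω → r ω) :
    pr p {ω | q ω} ≤ pr p {ω | r ω} := by
  classical
  rw [pr_setOf, pr_setOf]
  refine Finset.sum_le_sum fun ω _ => ?_
  by_cases h0 : p ω = 0
  · simp [h0]
  · by_cases hq : q ω
    · simp [hq, h ω h0 hq]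
    · simp only [hq, if_false]
      split_ifs
      exacts [hp ω, le_rfl]

theorem le_pr (hp : ∀ ω, 0 ≤ p ω) {q : Ω → Prop} {ω : Ω} (h : q ω) : p ω ≤ pr p {ω | q ω} := by
  classical
  rw [pr_setOf]
  calc p ω = if q ω then p ω else 0 := by simp [h]
    _ ≤ _ := Finset.single_le_sum (f := fun ω => if q ω then p ω else 0)
        (fun ω _ => by split_ifs; exacts [hp ω, le_rfl]) (Finset.mem_univ ω)

theorem pr_fiber_pos (hp : ∀ ω, 0 ≤ p ω) (X : Ω → α) {ω : Ω} (h : p ω ≠ 0) :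
    0 < pr p {ω' | X ω' = X ω} :=
  lt_of_lt_of_le (lt_of_le_of_ne (hp ω) h.symm) (le_pr hp (q := fun ω' => X ω' = X ω) rfl)

theorem ent_mono_term (hp : ∀ ω, 0 ≤ p ω) {X : Ω → α} {Y : Ω → β} (h : Determines p X Y) (ω : Ω) :
    p ω * (-Real.logb 2 (pr p {ω' | Y ω' = Y ω})) ≤
      p ω * (-Real.logb 2 (pr p {ω' | X ω' = X ω})) := by
  by_cases h0 : p ω = 0
  · simp [h0]
  refine mul_le_mul_of_nonneg_left (neg_le_neg ?_) (hp ω)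
  exact Real.logb_le_logb_of_le one_lt_two (pr_fiber_pos hp X h0)
    (pr_mono hp fun ω' h' hx => h ω' ω h' h0 hx)

theorem ent_mono (hp : ∀ ω, 0 ≤ p ω) {X : Ω → α} {Y : Ω → β} (h : Determines p X Y) :
    ent p Y ≤ ent p X :=
  Finset.sum_le_sum fun ω _ => ent_mono_term hp h ω

theorem determines_of_ent_le (hp : ∀ ω, 0 ≤ p ω) {X : Ω → α} {Y : Ω → β}
    (h : ent p (fun ω => (Y ω, X ω)) ≤ ent p X) : Determines p X Y := by
  classical
  have hdet : Determines p (fun ω => (Y ω, X ω)) X := .of_eq fun _ _ h => (Prod.ext_iff.1 h).2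
  have heq := (Finset.sum_eq_sum_iff_of_le fun ω _ => ent_mono_term hp hdet ω).1
    (le_antisymm (ent_mono hp hdet) h)
  intro ω ω' h0 h0' hx
  by_contra hne
  have hterm := mul_left_cancel₀ h0 (heq ω (Finset.mem_univ ω))
  have hpr := Real.logb_injOn_pos one_lt_two (pr_fiber_pos hp X h0)
    (pr_fiber_pos hp (fun ω => (Y ω, X ω)) h0) (neg_injective hterm)
  rw [pr_setOf, pr_setOf] at hpr
  refine (Finset.sum_lt_sum (fun v _ => ?_) ⟨ω', Finset.mem_univ _, ?_⟩).ne' hpr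
  · by_cases hv : X v = X ω
    · by_cases hy : Y v = Y ω <;> simp [hv, hy, hp v]
    · simp [hv]
  · have : ¬ Y ω' = Y ω := fun h => hne h.symm
    simp only [Prod.mk.injEq, this, false_and, if_false, hx, if_true]
    exact lt_of_le_of_ne (hp ω') h0'.symm

theorem ent_nonneg (hp : ∀ ω, 0 ≤ p ω) (hp1 : ∑ ω, p ω = 1) (X : Ω → α) : 0 ≤ ent p X := by
  refine Finset.sum_nonneg fun ω _ => ?_
  refine mul_nonneg (hp ω) (neg_nonneg.2 (Real.logb_nonpos one_lt_two ?_ ?_))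
  · exact (hp ω).trans (le_pr hp (q := fun ω' => X ω' = X ω) rfl)
  · calc pr p {ω' | X ω' = X ω} ≤ pr p {_ω' | True} := pr_mono hp fun _ _ _ => trivial
      _ = 1 := by simpa [pr] using hp1

theorem ent_const (hp1 : ∑ ω, p ω = 1) (c : α) : ent p (fun _ => c) = 0 := by
  simp [ent, pr, hp1]

theorem ent_eq_of_pr (hp1 : ∑ ω, p ω = 1) (X : Ω → α) (b : ℝ)
    (h : ∀ x, pr p {ω | X ω = x} = 1 / 2 ^ b) : ent p X = b := by
  simp only [ent, h, one_div, Real.logb_inv, neg_neg, Real.logb_rpow two_pos one_lt_two.ne']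
  rw [← Finset.sum_mul, hp1, one_mul]

theorem sum_fiber_ratio_le (hp : ∀ ω, 0 ≤ p ω) (X : Ω → α) (Y : Ω → β) (Z : Ω → γ) :
    ∑ ω, p ω * (pr p {ω' | (X ω', Z ω') = (X ω, Z ω)} * pr p {ω' | (Y ω', Z ω') = (Y ω, Z ω)} /
      (pr p {ω' | (X ω', Y ω', Z ω') = (X ω, Y ω, Z ω)} * pr p {ω' | Z ω' = Z ω})) ≤
      ∑ ω, p ω := by
  classical
  set f : Ω → ℝ := fun ω => pr p {ω' | (X ω', Y ω', Z ω') = (X ω, Y ω, Z ω)} with hf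
  set g : Ω → ℝ := fun ω => pr p {ω' | Z ω' = Z ω} with hg
  have hg0 : ∀ ω, 0 ≤ g ω := fun ω => (hp ω).trans (le_pr hp (q := fun ω' => Z ω' = Z ω) rfl)
  have hinner : ∀ u v, ∑ ω, (if (X u, Z u) = (X ω, Z ω) then p u else 0) *
      (if (Y v, Z v) = (Y ω, Z ω) then p v else 0) * (p ω / (f ω * g ω)) ≤
      p u * ((if Z v = Z u then p v else 0) / g u) := by
    intro u v
    by_cases hz : Z v = Z u
    · rw [if_pos hz]
      calc _ = ∑ ω, p u * p v / (pr p {ω | (X ω, Y ω, Z ω) = (X u, Y v, Z u)} * g u) *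
              (if (X ω, Y ω, Z ω) = (X u, Y v, Z u) then p ω else 0) := by
            refine Finset.sum_congr rfl fun ω _ => ?_
            by_cases h : (X ω, Y ω, Z ω) = (X u, Y v, Z u)
            · have hfe : f ω = pr p {ω | (X ω, Y ω, Z ω) = (X u, Y v, Z u)} := by
                simp only [hf, h]
              simp only [Prod.mk.injEq] at h
              obtain ⟨h1, h2, h3⟩ := h
              have hge : g ω = g u := by simp only [hg, h3]
              rw [hfe, hge]
              simp only [h1, h2, h3, hz, if_true]
              ring
            · rw [if_neg h, mul_zero]
              by_cases h1 : (X u, Z u) = (X ω, Z ω)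
              · rw [if_neg (c := (Y v, Z v) = (Y ω, Z ω)), mul_zero, zero_mul]
                intro h2
                simp only [Prod.mk.injEq] at h h1 h2
                exact h ⟨h1.1.symm, h2.1.symm, h1.2.symm⟩
              · rw [if_neg h1, zero_mul, zero_mul]
        _ = p u * (p v / g u) * (pr p {ω | (X ω, Y ω, Z ω) = (X u, Y v, Z u)} /
              pr p {ω | (X ω, Y ω, Z ω) = (X u, Y v, Z u)}) := by
            rw [← Finset.mul_sum, ← pr_setOf]
            ring
        _ ≤ p u * (p v / g u) * 1 :=
            mul_le_mul_of_nonneg_left (div_self_le_one _)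
              (mul_nonneg (hp u) (div_nonneg (hp v) (hg0 u)))
        _ = _ := mul_one _
    · rw [if_neg hz, zero_div, mul_zero]
      refine (Finset.sum_eq_zero fun ω _ => ?_).le
      by_cases h1 : (X u, Z u) = (X ω, Z ω)
      · rw [if_neg (c := (Y v, Z v) = (Y ω, Z ω)), mul_zero, zero_mul]
        intro h2
        simp only [Prod.mk.injEq] at h1 h2
        exact hz (h2.2.trans h1.2.symm)
      · rw [if_neg h1, zero_mul, zero_mul]
  calc _ = ∑ ω, ∑ u, ∑ v, (if (X u, Z u) = (X ω, Z ω) then p u else 0) *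
        (if (Y v, Z v) = (Y ω, Z ω) then p v else 0) * (p ω / (f ω * g ω)) := by
        refine Finset.sum_congr rfl fun ω _ => ?_
        change p ω * (_ / (f ω * g ω)) = _
        simp_rw [← Finset.sum_mul]
        rw [← Finset.sum_mul_sum, pr_setOf p fun ω' => (X ω', Z ω') = (X ω, Z ω),
          pr_setOf p fun ω' => (Y ω', Z ω') = (Y ω, Z ω)]
        ring
    _ = ∑ u, ∑ v, ∑ ω, (if (X u, Z u) = (X ω, Z ω) then p u else 0) *
        (if (Y v, Z v) = (Y ω, Z ω) then p v else 0) * (p ω / (f ω * g ω)) := by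
        rw [Finset.sum_comm]
        exact Finset.sum_congr rfl fun u _ => Finset.sum_comm
    _ ≤ ∑ u, ∑ v, p u * ((if Z v = Z u then p v else 0) / g u) :=
        Finset.sum_le_sum fun u _ => Finset.sum_le_sum fun v _ => hinner u v
    _ = ∑ u, p u * (g u / g u) := by
        refine Finset.sum_congr rfl fun u _ => ?_
        rw [← Finset.mul_sum, ← Finset.sum_div, ← pr_setOf]
    _ ≤ ∑ u, p u := Finset.sum_le_sum fun u _ =>
        mul_le_of_le_one_right (hp u) (div_self_le_one _)

theorem ent_submodular (hp : ∀ ω, 0 ≤ p ω) (X : Ω → α) (Y : Ω → β) (Z : Ω → γ) :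
    ent p (fun ω => (X ω, Y ω, Z ω)) + ent p Z ≤
      ent p (fun ω => (X ω, Z ω)) + ent p (fun ω => (Y ω, Z ω)) := by
  have key := sum_fiber_ratio_le hp X Y Z
  have hlog : (0 : ℝ) < Real.log 2 := Real.log_pos one_lt_two
  unfold ent
  rw [← Finset.sum_add_distrib, ← Finset.sum_add_distrib, ← sub_nonpos, ← Finset.sum_sub_distrib]
  refine (Finset.sum_le_sum (g := fun ω => (p ω * (pr p {ω' | (X ω', Z ω') = (X ω, Z ω)} *
    pr p {ω' | (Y ω', Z ω') = (Y ω, Z ω)} / (pr p {ω' | (X ω', Y ω', Z ω') = (X ω, Y ω, Z ω)} *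
    pr p {ω' | Z ω' = Z ω})) - p ω) / Real.log 2) fun ω _ => ?_).trans ?_
  · by_cases h0 : p ω = 0
    · simp [h0]
    have ha := pr_fiber_pos hp (fun ω => (X ω, Z ω)) h0
    have hb := pr_fiber_pos hp (fun ω => (Y ω, Z ω)) h0
    have hf := pr_fiber_pos hp (fun ω => (X ω, Y ω, Z ω)) h0
    have hg := pr_fiber_pos hp Z h0
    have hle := Real.log_le_sub_one_of_pos (div_pos (mul_pos ha hb) (mul_pos hf hg))
    rw [Real.log_div (mul_pos ha hb).ne' (mul_pos hf hg).ne', Real.log_mul ha.ne' hb.ne',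
      Real.log_mul hf.ne' hg.ne'] at hle
    rw [le_div_iff₀ hlog]
    refine Eq.trans_le ?_ ((mul_le_mul_of_nonneg_left hle (hp ω)).trans_eq (by ring))
    simp only [Real.logb]
    field_simp
    ring
  · rw [← Finset.sum_div, Finset.sum_sub_distrib]
    exact div_nonpos_of_nonpos_of_nonneg (sub_nonpos.2 key) hlog.le

theorem ent_pair_le (hp : ∀ ω, 0 ≤ p ω) (hp1 : ∑ ω, p ω = 1) (X : Ω → α) (Y : Ω → β) :
    ent p (fun ω => (X ω, Y ω)) ≤ ent p X + ent p Y := by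
  have h := ent_submodular hp X Y (fun _ => ())
  have h1 : ent p (fun ω => (X ω, Y ω)) ≤ ent p (fun ω => (X ω, Y ω, ())) :=
    ent_mono hp (.of_eq fun _ _ => by simp)
  have h2 : ent p (fun ω => (X ω, ())) ≤ ent p X := ent_mono hp (.of_eq fun _ _ => by simp)
  have h3 : ent p (fun ω => (Y ω, ())) ≤ ent p Y := ent_mono hp (.of_eq fun _ _ => by simp)
  rw [ent_const hp1] at h
  linarith

/-- Data processing: independence of `(X, Y)`, expressed by entropies, passes to functions of
the second component. -/
theorem ent_add_le_of_determines_right {δ : Type*} (hp : ∀ ω, 0 ≤ p ω) {X : Ω → α} {Y : Ω → β}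
    {Y' : Ω → δ} (hY : Determines p Y Y') (h : ent p X + ent p Y ≤ ent p (fun ω => (X ω, Y ω))) :
    ent p X + ent p Y' ≤ ent p (fun ω => (X ω, Y' ω)) := by
  have hs := ent_submodular hp X Y Y'
  have h1 : ent p (fun ω => (X ω, Y ω)) ≤ ent p (fun ω => (X ω, Y ω, Y' ω)) :=
    ent_mono hp (.of_eq fun _ _ => by simp +contextual)
  have h2 : ent p (fun ω => (Y ω, Y' ω)) ≤ ent p Y :=
    ent_mono hp fun ω ω' h0 h0' he => Prod.ext he (hY ω ω' h0 h0' he)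
  linarith

theorem ent_swap_le (hp : ∀ ω, 0 ≤ p ω) (X : Ω → α) (Y : Ω → β) :
    ent p (fun ω => (X ω, Y ω)) ≤ ent p (fun ω => (Y ω, X ω)) :=
  ent_mono hp (.of_eq fun _ _ => by simp +contextual)

theorem ent_add_le_of_determines_left {δ : Type*} (hp : ∀ ω, 0 ≤ p ω) {X : Ω → α} {Y : Ω → β}
    {X' : Ω → δ} (hX : Determines p X X') (h : ent p X + ent p Y ≤ ent p (fun ω => (X ω, Y ω))) :
    ent p X' + ent p Y ≤ ent p (fun ω => (X' ω, Y ω)) := by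
  have := ent_add_le_of_determines_right hp hX
    ((add_comm _ _).trans_le (h.trans (ent_swap_le hp X Y)))
  linarith [ent_swap_le hp Y X']

/-- A one-time-pad argument: if `V` is independent of `T`, `V` is determined by `(T, U)` and `U` has
no more entropy than `V`, then `(V, T)` determines `U`. -/
theorem determines_key (hp : ∀ ω, 0 ≤ p ω) (hp1 : ∑ ω, p ω = 1) {V : Ω → α} {T : Ω → β} {U : Ω → γ}
    (hdec : Determines p (fun ω => (T ω, U ω)) V) (hU : ent p U ≤ ent p V)
    (hind : ent p V + ent p T ≤ ent p (fun ω => (V ω, T ω))) :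
    Determines p (fun ω => (V ω, T ω)) U := by
  refine determines_of_ent_le hp ?_
  have h1 : ent p (fun ω => (U ω, V ω, T ω)) ≤ ent p (fun ω => (T ω, U ω)) :=
    ent_mono hp fun ω ω' h0 h0' he => by
      have hv := hdec ω ω' h0 h0' he
      simp only [Prod.mk.injEq] at he ⊢
      exact ⟨he.2, hv, he.1⟩
  linarith [ent_pair_le hp hp1 T U]

section Files

variable {N B : ℕ} {W : Fin N → Ω → Fin (2 ^ B)}

theorem ent_file (hp1 : ∑ ω, p ω = 1)
    (hWunif : ∀ (n : Fin N) (w : Fin (2 ^ B)), pr p {ω | W n ω = w} = 1 / (2 ^ B : ℝ)) (n : Fin N) :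
    ent p (W n) = B :=
  ent_eq_of_pr hp1 _ _ fun w => by rw [hWunif, Real.rpow_natCast]

theorem ent_files_le (hp : ∀ ω, 0 ≤ p ω) (hp1 : ∑ ω, p ω = 1)
    (hWunif : ∀ (n : Fin N) (w : Fin (2 ^ B)), pr p {ω | W n ω = w} = 1 / (2 ^ B : ℝ))
    (s : Finset (Fin N)) : ent p (fun ω (n : s) => W n ω) ≤ s.card * B := by
  induction s using Finset.induction_on with
  | empty =>
    have : ent p (fun ω (n : (∅ : Finset (Fin N))) => W n ω) ≤ ent p (fun _ => ()) :=
      ent_mono hp (.of_eq fun _ _ _ => funext fun n => absurd n.2 (Finset.notMem_empty _))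
    simpa [ent_const hp1] using this
  | insert a s ha ih =>
    have h1 : ent p (fun ω (n : (insert a s : Finset (Fin N))) => W n ω) ≤
        ent p (fun ω => (W a ω, fun (n : s) => W n ω)) :=
      ent_mono hp (.of_eq fun ω ω' h => by
        simp only [Prod.mk.injEq, funext_iff, Subtype.forall] at h ⊢
        intro n hn
        rcases Finset.mem_insert.1 hn with rfl | hn
        exacts [h.1, h.2 n hn])
    have h2 := ent_pair_le hp hp1 (W a) (fun ω (n : s) => W n ω)
    rw [ent_file hp1 hWunif] at h2
    rw [Finset.card_insert_of_notMem ha]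
    push_cast
    linarith

theorem ent_files (hp : ∀ ω, 0 ≤ p ω) (hp1 : ∑ ω, p ω = 1)
    (hWunif : ∀ (n : Fin N) (w : Fin (2 ^ B)), pr p {ω | W n ω = w} = 1 / (2 ^ B : ℝ))
    (hWind : ∀ w : Fin N → Fin (2 ^ B),
      pr p {ω | ∀ n : Fin N, W n ω = w n} = ∏ n : Fin N, pr p {ω | W n ω = w n})
    (s : Finset (Fin N)) : ent p (fun ω (n : s) => W n ω) = s.card * B := by
  refine le_antisymm (ent_files_le hp hp1 hWunif s) ?_
  have hall : ent p (fun ω n => W n ω) = (N * B : ℝ) := by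
    refine ent_eq_of_pr hp1 _ _ fun w => ?_
    simp only [funext_iff]
    rw [hWind]
    simp only [hWunif, Finset.prod_const, Finset.card_univ, Fintype.card_fin]
    rw [mul_comm, Real.rpow_mul two_pos.le, Real.rpow_natCast, Real.rpow_natCast, one_div_pow]
  have h1 : ent p (fun ω n => W n ω) ≤
      ent p (fun ω => (fun (n : s) => W n ω, fun (n : (sᶜ : Finset (Fin N))) => W n ω)) :=
    ent_mono hp (.of_eq fun ω ω' h => by
      simp only [Prod.mk.injEq, funext_iff, Subtype.forall] at h ⊢
      intro n
      by_cases hn : n ∈ s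
      exacts [h.1 n hn, h.2 n (Finset.mem_compl.2 hn)])
  have h2 := ent_pair_le hp hp1 (fun ω (n : s) => W n ω)
    (fun ω (n : (sᶜ : Finset (Fin N))) => W n ω)
  have h3 := ent_files_le hp hp1 hWunif sᶜ
  have h4 : (s.card : ℝ) + (sᶜ.card : ℝ) = N := by
    exact_mod_cast (Finset.card_add_card_compl s).trans (Fintype.card_fin N)
  have h5 : (s.card : ℝ) * B + sᶜ.card * B = N * B := by rw [← add_mul, h4]
  linarith

end Files

end Entropy

/-- The rate of the PDA-based scheme is at most the number of users. -/
theorem pda_rate_le {Λ F Z S : ℕ} (hZF : Z < F) {P : Fin F → Fin Λ → Option (Fin S)}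
    (hP : IsPDA Λ F Z S P) {tau : Fin S → Fin Λ} (htau : ∀ s, ∃ j, P j (tau s) = some s)
    (L : Fin Λ → ℕ) :
    (∑ s, (L (tau s) : ℝ)) / ((F : ℝ) - (Z : ℝ)) ≤ ((∑ l, L l : ℕ) : ℝ) := by
  have hcard : ∀ l, (Finset.univ.filter fun s => tau s = l).card ≤ F - Z := by
    intro l
    choose j hj using htau
    have hstar : (Finset.univ.filter fun i => ¬ P i l = none).card = F - Z := by
      have := Finset.card_filter_add_card_filter_not (s := Finset.univ) (fun i => P i l = none)
      rw [hP.1 l, Finset.card_univ, Fintype.card_fin] at this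
      omega
    rw [← hstar]
    refine Finset.card_le_card_of_injOn j ?_ ?_
    · intro s hs
      have hs : tau s = l := by simpa using hs
      subst hs
      simp [hj s]
    · intro s hs s' hs' he
      have hs : tau s = l := by simpa using hs
      have hs' : tau s' = l := by simpa using hs'
      have h1 := hj s
      have h2 := hj s'
      rw [hs, he] at h1
      rw [hs'] at h2
      exact Option.some_injective _ (h1.symm.trans h2)
  have hnat : ∑ s, L (tau s) ≤ (∑ l, L l) * (F - Z) := by
    rw [← Finset.sum_fiberwise Finset.univ tau, Finset.sum_mul]
    refine Finset.sum_le_sum fun l _ => ?_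
    rw [Finset.sum_congr rfl fun s hs => by rw [(Finset.mem_filter.1 hs).2], Finset.sum_const,
      smul_eq_mul, mul_comm]
    exact Nat.mul_le_mul_left _ (hcard l)
  have hpos : (0 : ℝ) < (F : ℝ) - Z := sub_pos.2 (by exact_mod_cast hZF)
  rw [div_le_iff₀ hpos, ← Nat.cast_sub hZF.le]
  exact_mod_cast hnat

/-- Cut-set converse: `ℓ` users sharing one helper cache, each with a user cache of one file, force
the rate to be at least `ℓ`. -/
theorem card_le_rate {Ω : Type*} [Fintype Ω] {p : Ω → ℝ} (hp : ∀ ω, 0 ≤ p ω) (hp1 : ∑ ω, p ω = 1)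
    {ℓ K N B : ℕ} {R : ℝ} (hB : 0 < B) (hℓ : ℓ ≤ K) (hN : 2 * K ≤ N)
    {W : Fin N → Ω → Fin (2 ^ B)}
    (hWunif : ∀ (n : Fin N) (w : Fin (2 ^ B)), pr p {ω | W n ω = w} = 1 / (2 ^ B : ℝ))
    (hWind : ∀ w : Fin N → Fin (2 ^ B),
      pr p {ω | ∀ n : Fin N, W n ω = w n} = ∏ n : Fin N, pr p {ω | W n ω = w n})
    {ZT : Type*} (C : Ω → ZT) {UT : Fin K → Type*} (U : ∀ k, Ω → UT k)
    (hU : ∀ k, ent p (U k) ≤ B)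
    {XT : (Fin K → Fin N) → Type*} (X : ∀ d, Ω → XT d) (hX : ∀ d, ent p (X d) ≤ R * B)
    (hdec : ∀ (d : Fin K → Fin N) (k : Fin K), k.val < ℓ →
      condEnt p (W (d k)) (fun ω => (X d ω, C ω, U k ω)) = 0)
    (hsec : ∀ (d : Fin K → Fin N) (k : Fin K), k.val < ℓ →
      mutInf p (fun ω (n : {n : Fin N // n ≠ d k}) => W n.val ω)
        (fun ω => (X d ω, C ω, U k ω)) = 0) :
    (ℓ : ℝ) ≤ R := by
  classical
  have hB' : (0 : ℝ) < B := by exact_mod_cast hB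
  have hdet : ∀ (d : Fin K → Fin N) (k : Fin K), k.val < ℓ →
      Determines p (fun ω => (X d ω, C ω, U k ω)) (W (d k)) := fun d k hk =>
    determines_of_ent_le hp (sub_nonpos.1 (hdec d k hk).le)
  let d : Fin K → Fin N := fun k => ⟨k.val, by omega⟩
  let d' : Fin K → Fin N := fun k => ⟨K + k.val, by omega⟩
  rcases Nat.eq_zero_or_pos ℓ with rfl | hpos
  · have h := (ent_nonneg hp hp1 (X d)).trans (hX d)
    simpa using nonneg_of_mul_nonneg_left h hB'
  let k0 : Fin K := ⟨0, by omega⟩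
  let s : Finset (Fin N) := (Finset.univ.filter fun k : Fin K => k.val < ℓ).image d
  let s' : Finset (Fin N) := (Finset.univ.filter fun k : Fin K => k.val < ℓ ∧ k ≠ k0).image d'
  let D : Ω → (s → Fin (2 ^ B)) := fun ω n => W n ω
  let D' : Ω → (s' → Fin (2 ^ B)) := fun ω n => W n ω
  let Y : Ω → XT d' × ZT × UT k0 := fun ω => (X d' ω, C ω, U k0 ω)
  let E : Ω → ZT × (∀ k : {k : Fin K // k.val < ℓ}, UT k) := fun ω => (C ω, fun k => U k ω)
  have hdinj : Function.Injective d := fun a b h => Fin.ext (by simpa [d] using h)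
  have hscard : s.card = ℓ := by
    rw [Finset.card_image_of_injective _ hdinj, Fin.card_filter_val_lt, min_eq_right hℓ]
  have hdisj : Disjoint s s' := by
    rw [Finset.disjoint_left]
    simp only [s, s', d, d', Finset.mem_image, Finset.mem_filter, Finset.mem_univ, true_and]
    rintro _ ⟨a, -, rfl⟩ ⟨b, -, h⟩
    have := congrArg Fin.val h
    simp only at this
    omega
  have hne_s : ∀ n ∈ s, n ≠ d' k0 := by
    simp only [s, d, d', Finset.mem_image, Finset.mem_filter, Finset.mem_univ, true_and]
    rintro _ ⟨a, -, rfl⟩ h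
    have := congrArg Fin.val h
    simp only at this
    omega
  have hne_s' : ∀ n ∈ s', n ≠ d' k0 := by
    simp only [s', d', Finset.mem_image, Finset.mem_filter, Finset.mem_univ, true_and]
    rintro _ ⟨a, ha, rfl⟩ h
    refine ha.2 (Fin.ext ?_)
    have := congrArg Fin.val h
    simp only at this
    omega
  have hindY : ent p (fun ω (n : {n : Fin N // n ≠ d' k0}) => W n.val ω) + ent p Y ≤
      ent p (fun ω => (fun (n : {n : Fin N // n ≠ d' k0}) => W n.val ω, Y ω)) :=
    sub_nonpos.1 (hsec d' k0 hpos).le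
  have hkeys : ∀ k : Fin K, k.val < ℓ → Determines p (fun ω => (D' ω, Y ω)) (U k) := by
    intro k hk
    by_cases hk0 : k = k0
    · subst hk0
      exact .of_eq fun _ _ h => by simp only [Y, Prod.mk.injEq] at h; exact h.2.2.2
    have hmem : d' k ∈ s' := Finset.mem_image_of_mem _ (by simp [hk, hk0])
    have hkey : Determines p (fun ω => (W (d' k) ω, X d' ω, C ω)) (U k) := by
      refine determines_key hp hp1 (T := fun ω => (X d' ω, C ω)) ?_ ?_ ?_
      · intro ω ω' h0 h0' h
        refine hdet d' k hk ω ω' h0 h0' ?_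
        simp only [Prod.mk.injEq] at h ⊢
        exact ⟨h.1.1, h.1.2, h.2⟩
      · rw [ent_file hp1 hWunif]
        exact hU k
      · refine ent_add_le_of_determines_left hp (.of_eq fun ω ω' h => ?_)
          (ent_add_le_of_determines_right hp (.of_eq fun ω ω' h => ?_) hindY)
        · exact congrFun h ⟨d' k, hne_s' _ hmem⟩
        · simp only [Y, Prod.mk.injEq] at h ⊢
          exact ⟨h.1, h.2.1⟩
    intro ω ω' h0 h0' h
    refine hkey ω ω' h0 h0' ?_
    simp only [Y, Prod.mk.injEq] at h ⊢
    exact ⟨congrFun h.1 ⟨d' k, hmem⟩, h.2.1, h.2.2.1⟩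
  have hE : Determines p (fun ω => (D' ω, Y ω)) E := by
    intro ω ω' h0 h0' h
    refine Prod.ext ?_ (funext fun k => hkeys k k.2 ω ω' h0 h0' h)
    simp only [Y, Prod.mk.injEq] at h
    exact h.2.2.1
  have hD : ent p D = ℓ * B := by rw [← hscard]; exact ent_files hp hp1 hWunif hWind s
  have hD' : ent p D' = s'.card * B := ent_files hp hp1 hWunif hWind s'
  have hDD' : ent p D + ent p D' ≤ ent p (fun ω => (D ω, D' ω)) := by
    have h1 := ent_files hp hp1 hWunif hWind (s ∪ s')
    have h2 : ent p (fun ω (n : (s ∪ s' : Finset (Fin N))) => W n ω) ≤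
        ent p (fun ω => (D ω, D' ω)) :=
      ent_mono hp (.of_eq fun ω ω' h => by
        simp only [Prod.mk.injEq] at h
        funext ⟨n, hn⟩
        rcases Finset.mem_union.1 hn with hn | hn
        exacts [congrFun h.1 ⟨n, hn⟩, congrFun h.2 ⟨n, hn⟩])
    rw [Finset.card_union_of_disjoint hdisj, hscard] at h1
    push_cast at h1
    linarith
  have hDG : ent p D + ent p (fun ω => (D' ω, Y ω)) ≤ ent p (fun ω => (D ω, D' ω, Y ω)) := by
    have h1 : ent p (fun ω => (D ω, D' ω)) + ent p Y ≤ ent p (fun ω => ((D ω, D' ω), Y ω)) := by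
      refine ent_add_le_of_determines_left hp (.of_eq fun ω ω' h => ?_) hindY
      exact Prod.ext (funext fun n => congrFun h ⟨n, hne_s n n.2⟩)
        (funext fun n => congrFun h ⟨n, hne_s' n n.2⟩)
    have h2 : ent p (fun ω => ((D ω, D' ω), Y ω)) ≤ ent p (fun ω => (D ω, D' ω, Y ω)) :=
      ent_mono hp (.of_eq fun _ _ => by simp +contextual)
    linarith [ent_pair_le hp hp1 D' Y]
  have hDE := ent_add_le_of_determines_right hp hE hDG
  have hXE : ent p (fun ω => (D ω, E ω)) ≤ ent p (fun ω => (X d ω, E ω)) := by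
    refine ent_mono hp fun ω ω' h0 h0' h => ?_
    simp only [E, Prod.mk.injEq] at h
    refine Prod.ext (funext fun n => ?_) (Prod.ext h.2.1 h.2.2)
    obtain ⟨k, hk, hkn⟩ := Finset.mem_image.1 n.2
    have hk : k.val < ℓ := by simpa using hk
    have := hdet d k hk ω ω' h0 h0'
      (Prod.ext h.1 (Prod.ext h.2.1 (congrFun h.2.2 ⟨k, hk⟩)))
    rw [hkn] at this
    exact this
  have hfin : (ℓ : ℝ) * B ≤ R * B := by
    linarith [ent_pair_le hp hp1 (X d) E, hX d]
  exact le_of_mul_le_mul_right hfin hB'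

/-- order-optimality: let `P` be a `(Λ,F,Z,S)` PDA with `Z < F`, let `L` be
an association profile with `∑_λ L_λ = K`, and suppose `N ≥ 2K`. Let
`R_s = (∑_{s'} L (τ_{s'}))/(F − Z)` be the worst-case rate of the PDA-based secretive coded
caching scheme, where `τ_{s'}` is the least column of `P` in which `s'` appears. Then for
any secretive shared-cache scheme with parameters `(Λ, K, M, M_U = 1, N, B)` and rate `R`
(with users `1, …, L₁` attached to cache 1), one has `R_s ≤ K ≤ Λ·L₁ ≤ Λ·R`; in
particular `R_s ≤ Λ·R`, i.e. the rate achieved by the PDA-based secretive coded caching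
scheme is within a multiplicative factor `Λ` of the optimal secretive rate. -/
theorem statement15
    -- the PDA and its parameters
    (Λ F Z S K N B : ℕ) (M R : ℝ)
    (hΛ : 0 < Λ) (hF : 0 < F) (hZ : 0 < Z) (hS : 0 < S) (hB : 0 < B)
    (hZF : Z < F) (hN : 2 * K ≤ N)
    (P : Fin F → Fin Λ → Option (Fin S)) (hP : IsPDA Λ F Z S P)
    (tau : Fin S → Fin Λ)
    (htau : ∀ s : Fin S, (∃ j : Fin F, P j (tau s) = some s) ∧
      ∀ l : Fin Λ, (∃ j : Fin F, P j l = some s) → tau s ≤ l)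
    -- association profile and user-to-cache assignment; cache 1 serves users 1,…,L₁
    (L : Fin Λ → ℕ) (hL : Antitone L) (hKsum : ∑ l : Fin Λ, L l = K)
    (lam : Fin K → Fin Λ)
    (hlam1 : ∀ k : Fin K, k.val < L ⟨0, hΛ⟩ → lam k = ⟨0, hΛ⟩)
    -- the underlying finite probability space
    (Ω : Type) [Fintype Ω] (p : Ω → ℝ) (hp0 : ∀ ω : Ω, 0 ≤ p ω) (hp1 : ∑ ω : Ω, p ω = 1)
    -- the `N` files: mutually independent, each uniform over a set of size `2^B`
    (W : Fin N → Ω → Fin (2 ^ B))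
    (hWunif : ∀ (n : Fin N) (w : Fin (2 ^ B)), pr p {ω | W n ω = w} = 1 / (2 ^ B : ℝ))
    (hWind : ∀ w : Fin N → Fin (2 ^ B),
      pr p {ω | ∀ n : Fin N, W n ω = w n} = ∏ n : Fin N, pr p {ω | W n ω = w n})
    -- helper-cache contents
    (ZT : Fin Λ → Type) (Zc : ∀ l : Fin Λ, Ω → ZT l)
    (hZc : ∀ l : Fin Λ, ent p (Zc l) ≤ M * B)
    -- user-cache contents, of size `M_U = 1` file
    (UT : Fin K → Type) (U : ∀ k : Fin K, Ω → UT k)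
    (hU : ∀ k : Fin K, ent p (U k) ≤ 1 * B)
    -- transmissions
    (XT : (Fin K → Fin N) → Type) (X : ∀ d : Fin K → Fin N, Ω → XT d)
    (hX : ∀ d : Fin K → Fin N, ent p (X d) ≤ R * B)
    -- decodability
    (hdec : ∀ (d : Fin K → Fin N) (k : Fin K),
      condEnt p (W (d k)) (fun ω => (X d ω, Zc (lam k) ω, U k ω)) = 0)
    -- secrecy
    (hsec : ∀ (d : Fin K → Fin N) (k : Fin K),
      mutInf p (fun ω (n : {n : Fin N // n ≠ d k}) => W n.val ω)
        (fun ω => (X d ω, Zc (lam k) ω, U k ω)) = 0) :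
    (∑ s : Fin S, (L (tau s) : ℝ)) / ((F : ℝ) - (Z : ℝ)) ≤ (K : ℝ) ∧
    (K : ℝ) ≤ (Λ : ℝ) * (L ⟨0, hΛ⟩ : ℝ) ∧
    (Λ : ℝ) * (L ⟨0, hΛ⟩ : ℝ) ≤ (Λ : ℝ) * R ∧
    (∑ s : Fin S, (L (tau s) : ℝ)) / ((F : ℝ) - (Z : ℝ)) ≤ (Λ : ℝ) * R := by
  have h1 := pda_rate_le hZF hP (fun s => (htau s).1) L
  rw [hKsum] at h1
  have hmax : ∀ l, L l ≤ L ⟨0, hΛ⟩ := fun l => hL (Nat.zero_le _)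
  have h2 : (K : ℝ) ≤ (Λ : ℝ) * (L ⟨0, hΛ⟩ : ℝ) := by
    have : K ≤ Λ * L ⟨0, hΛ⟩ := by
      rw [← hKsum]
      simpa using Finset.sum_le_card_nsmul Finset.univ L _ fun l _ => hmax l
    exact_mod_cast this
  have hLK : L ⟨0, hΛ⟩ ≤ K := by
    rw [← hKsum]
    exact Finset.single_le_sum (fun _ _ => Nat.zero_le _) (Finset.mem_univ _)
  have h3 : (L ⟨0, hΛ⟩ : ℝ) ≤ R := by
    refine card_le_rate hp0 hp1 hB hLK hN hWunif hWind (Zc ⟨0, hΛ⟩) U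
      (fun k => by simpa using hU k) X hX (fun d k hk => ?_) (fun d k hk => ?_)
    · have h := hdec d k
      rwa [hlam1 k hk] at h
    · have h := hsec d k
      rwa [hlam1 k hk] at h
  have h4 := mul_le_mul_of_nonneg_left h3 (Nat.cast_nonneg (α := ℝ) Λ)
  exact ⟨h1, h2, h4, h1.trans (h2.trans h4)⟩
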